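/- arXiv:1605.08977 — 2 statements merged into one kernel-verified Lean document; each statement's English description precedes it below -/
import Mathlib

section
/- Let φ ∈ Diff^∞([0,∞)) be expanding (φ(x) > x for x > 0) and infinitely tangent to the identity at 0, and λ ∈ ℂ with |λ| > 1. If β : [0,∞) → ℂ is smooth on (0,∞) and satisfies β(φ(x)) = λβ(x) for all x > 0, then β extends to a smooth function on [0,∞) that is flat at 0 (all derivatives vanish at x = 0). -/
open Set Filter Topology

lemma aux_bdd (φ : ℝ → ℝ) (hc : ContinuousOn φ (Ici 0)) (hexp : ∀ x > (0:ℝ), φ x > x)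
    (u : ℝ → ℝ) (hu : ContinuousOn u (Ioi 0)) (q : ℝ) (hq0 : 0 ≤ q) (hq : q < 1)
    (h : ∀ᶠ x in 𝓝[>] (0:ℝ), u x ≤ q * u (φ x) + 1) :
    ∃ C, ∀ᶠ x in 𝓝[>] (0:ℝ), u x ≤ C := by
  obtain ⟨d', hd', hd⟩ := mem_nhdsGT_iff_exists_Ioc_subset.1 h
  have hdpos : (0:ℝ) < d' := hd'
  obtain ⟨T, hT⟩ := (isCompact_Icc.image_of_continuousOn
    (hc.mono (fun x (hx : x ∈ Icc 0 d') => hx.1))).bddAbove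
  obtain ⟨M, hM⟩ := (isCompact_Icc.image_of_continuousOn
    (hu.mono (fun x (hx : x ∈ Icc d' T) => lt_of_lt_of_le hdpos hx.1))).bddAbove
  have h1q : 0 < 1 - q := by linarith
  obtain ⟨C, hC⟩ : ∃ C, C > max M (1 / (1 - q)) := exists_gt _
  have hCM : M < C := lt_of_le_of_lt (le_max_left _ _) hC
  have hCq : q * C + 1 < C := by
    have := lt_of_le_of_lt (le_max_right _ _) hC
    rw [div_lt_iff₀ h1q] at this
    linarith
  refine ⟨C, ?_⟩
  filter_upwards [Ioc_mem_nhdsGT hdpos] with x0 hx0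
  by_contra hcon
  push Not at hcon
  have hcl : IsClosed (Icc x0 d' ∩ u ⁻¹' (Ici C)) := 
    (hu.mono (fun x (hx : x ∈ Icc x0 d') => lt_of_lt_of_le hx0.1 hx.1)).preimage_isClosed_of_isClosed
      isClosed_Icc isClosed_Ici
  have hK : IsCompact (Icc x0 d' ∩ u ⁻¹' (Ici C)) :=
    isCompact_Icc.of_isClosed_subset hcl inter_subset_left
  obtain ⟨s, ⟨⟨hs1, hs2⟩, hs3⟩, hs⟩ := hK.exists_isGreatest ⟨x0, ⟨le_refl _, hx0.2⟩, hcon.le⟩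
  have hs0 : 0 < s := lt_of_lt_of_le hx0.1 hs1
  have h1 : u s ≤ q * u (φ s) + 1 := hd ⟨hs0, hs2⟩
  have h2 := hexp s hs0
  have hs3 : C ≤ u s := hs3
  have h3 : u (φ s) ≤ C := by
    by_cases hφ : φ s ≤ d'
    · by_contra hh
      push Not at hh
      have := hs ⟨⟨by linarith, hφ⟩, hh.le⟩
      linarith
    · push Not at hφ
      have : u (φ s) ≤ M := hM (mem_image_of_mem u ⟨hφ.le, hT (mem_image_of_mem φ ⟨hs0.le, hs2⟩)⟩)
      linarith
  nlinarith [mul_le_mul_of_nonneg_left h3 hq0]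

lemma aux_tendsto_phi (φ : ℝ → ℝ) (hc : ContinuousOn φ (Ici 0)) (hφ0 : φ 0 = 0)
    (hexp : ∀ x > (0:ℝ), φ x > x) : Tendsto φ (𝓝[>] 0) (𝓝[>] 0) := by
  rw [tendsto_nhdsWithin_iff]
  refine ⟨?_, ?_⟩
  · have := hc 0 (mem_Ici.2 le_rfl)
    have h2 : Tendsto φ (𝓝[≥] 0) (𝓝 (φ 0)) := this
    rw [hφ0] at h2
    exact h2.mono_left (nhdsWithin_mono _ Ioi_subset_Ici_self)
  · filter_upwards [self_mem_nhdsWithin] with x hx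
    exact lt_trans hx (hexp x hx)

lemma aux_lim (φ : ℝ → ℝ) (hc : ContinuousOn φ (Ici 0)) (hφ0 : φ 0 = 0)
    (hexp : ∀ x > (0:ℝ), φ x > x)
    (u : ℝ → ℝ) (hu : ContinuousOn u (Ioi 0)) (hu0 : ∀ x, 0 ≤ u x)
    (q : ℝ) (hq0 : 0 ≤ q) (hq : q < 1)
    (e : ℝ → ℝ) (he : Tendsto e (𝓝[>] 0) (𝓝 0))
    (h : ∀ᶠ x in 𝓝[>] (0:ℝ), u x ≤ q * u (φ x) + e x) :
    Tendsto u (𝓝[>] 0) (𝓝 0) := by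
  have key : ∀ ε > 0, ∀ᶠ x in 𝓝[>] (0:ℝ), u x ≤ q * u (φ x) + ε := by
    intro ε hε
    filter_upwards [h, he.eventually (gt_mem_nhds hε)] with x h1 h2
    linarith
  obtain ⟨C, hC⟩ := aux_bdd φ hc hexp u hu q hq0 hq (key 1 one_pos)
  have hφt := aux_tendsto_phi φ hc hφ0 hexp
  have h1q : 0 < 1 - q := by linarith
  have it : ∀ ε > 0, ∀ n : ℕ, ∀ᶠ x in 𝓝[>] (0:ℝ), u x ≤ q ^ n * C + ε / (1 - q) := by
    intro ε hε n
    induction n with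
    | zero =>
      filter_upwards [hC] with x hx
      have : 0 < ε / (1 - q) := by positivity
      simp; linarith
    | succ n ih =>
      filter_upwards [hφt.eventually ih, key ε hε] with x h1 h2
      have h3 := mul_le_mul_of_nonneg_left h1 hq0
      have h4 : q * (ε / (1 - q)) + ε = ε / (1 - q) := by field_simp; ring
      have : q * (q ^ n * C + ε / (1 - q)) = q ^ (n+1) * C + q * (ε / (1 - q)) := by ring
      linarith
  rw [Metric.tendsto_nhds]
  intro η hη
  have h5 : Tendsto (fun n : ℕ => q ^ n * C) atTop (𝓝 0) := by
    simpa using (tendsto_pow_atTop_nhds_zero_of_lt_one hq0 hq).mul_const C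
  obtain ⟨n, hn⟩ := (h5.eventually (gt_mem_nhds (half_pos hη))).exists
  have hε : 0 < (η / 2) * (1 - q) := by positivity
  filter_upwards [it _ hε n] with x hx
  rw [mul_div_cancel_right₀ _ h1q.ne'] at hx
  rw [Real.dist_eq, sub_zero, abs_of_nonneg (hu0 x)]
  linarith

noncomputable def coefP (φ : ℝ → ℝ) : ℕ → ℕ → ℝ → ℝ
  | 0, 0 => fun _ => 1
  | 0, _ + 1 => fun _ => 0
  | k + 1, 0 => derivWithin (coefP φ k 0) (Ici 0)
  | k + 1, j + 1 => fun x => derivWithin (coefP φ k (j + 1)) (Ici 0) x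
      + coefP φ k j x * derivWithin φ (Ici 0) x

lemma coefP_smooth (φ : ℝ → ℝ) (hφs : ContDiffOn ℝ (⊤ : ℕ∞) φ (Ici 0)) (k j : ℕ) :
    ContDiffOn ℝ (⊤ : ℕ∞) (coefP φ k j) (Ici 0) := by
  have D : ∀ f : ℝ → ℝ, ContDiffOn ℝ (⊤ : ℕ∞) f (Ici 0) →
      ContDiffOn ℝ (⊤ : ℕ∞) (derivWithin f (Ici 0)) (Ici 0) := fun f hf =>
    hf.derivWithin (uniqueDiffOn_Ici 0) (by simp)
  induction k generalizing j with
  | zero => cases j <;> simp only [coefP] <;> exact contDiffOn_const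
  | succ k ih =>
    cases j with
    | zero => exact D _ (ih 0)
    | succ j => exact (D _ (ih _)).add ((ih _).mul (D _ hφs))

lemma coefP_gt (φ : ℝ → ℝ) (k j : ℕ) (h : k < j) : coefP φ k j = fun _ => 0 := by
  induction k generalizing j with
  | zero => cases j with
    | zero => omega
    | succ j => rfl
  | succ k ih =>
    cases j with
    | zero => omega
    | succ j =>
      funext x
      simp [coefP, ih (j+1) (by omega), ih j (by omega)]

lemma coefP_diag (φ : ℝ → ℝ) (k : ℕ) (x : ℝ) :
    coefP φ k k x = (derivWithin φ (Ici 0) x) ^ k := by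
  induction k with
  | zero => simp [coefP]
  | succ k ih => simp [coefP, coefP_gt φ k (k+1) (by omega), ih, pow_succ]

lemma aux_rec (φ : ℝ → ℝ) (hφs : ContDiffOn ℝ (⊤ : ℕ∞) φ (Set.Ici 0))
    (hexp : ∀ x > (0:ℝ), φ x > x) (lam : ℂ) (b : ℕ → ℝ → ℂ)
    (hb : ∀ k, ∀ x > 0, HasDerivAt (b k) (b (k+1) x) x)
    (heq : ∀ x > (0:ℝ), b 0 (φ x) = lam * b 0 x) (k : ℕ) :
    ∀ x > 0, lam * b k x = ∑ j ∈ Finset.range (k+1), coefP φ k j x • b j (φ x) := by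
  have Dat : ∀ f : ℝ → ℝ, ContDiffOn ℝ (⊤ : ℕ∞) f (Ici 0) → ∀ x > 0,
      HasDerivAt f (derivWithin f (Ici 0) x) x := fun f hf x hx =>
    ((hf.differentiableOn (by simp) x (mem_Ici.2 (le_of_lt hx))).hasDerivWithinAt).hasDerivAt
      (Ici_mem_nhds hx)
  induction k with
  | zero => intro x hx; simp [coefP, heq x hx]
  | succ k ih =>
    intro x hx
    have h1 : HasDerivAt (fun x => lam * b k x) (lam * b (k+1) x) x := (hb k x hx).const_mul lam
    have h2 : HasDerivAt (fun x => ∑ j ∈ Finset.range (k+1), coefP φ k j x • b j (φ x))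
        (∑ j ∈ Finset.range (k+1), (coefP φ k j x • (derivWithin φ (Ici 0) x • b (j+1) (φ x))
          + derivWithin (coefP φ k j) (Ici 0) x • b j (φ x))) x := by
      refine HasDerivAt.fun_sum fun j _ => ?_
      exact (Dat _ (coefP_smooth φ hφs k j) x hx).smul
        ((hb j (φ x) (lt_trans hx (hexp x hx))).scomp x (Dat φ hφs x hx))
    have h3 := h2.congr_of_eventuallyEq (f₁ := fun x => lam * b k x)
      (by filter_upwards [Ioi_mem_nhds hx] with y hy using ih y hy)
    rw [h1.unique h3, Finset.sum_add_distrib, Finset.sum_range_succ' _ (k+1)]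
    simp only [coefP, add_smul, Finset.sum_add_distrib, smul_smul]
    rw [Finset.sum_range_succ' (fun j => derivWithin (coefP φ k j) (Ici 0) x • b j (φ x)) k,
      Finset.sum_range_succ (fun j => derivWithin (coefP φ k (j+1)) (Ici 0) x • b (j+1) (φ x)) k,
      coefP_gt φ k (k+1) (by omega)]
    simp
    abel

theorem stmt5 (φ : ℝ → ℝ) (hφs : ContDiffOn ℝ (⊤ : ℕ∞) φ (Set.Ici 0))
    (hbij : Set.BijOn φ (Set.Ici 0) (Set.Ici 0)) (hφ0 : φ 0 = 0)
    (hexp : ∀ x > (0:ℝ), φ x > x)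
    (hflat : ∀ k : ℕ, iteratedDerivWithin k (fun x => φ x - x) (Set.Ici 0) 0 = 0)
    (lam : ℂ) (hlam : 1 < ‖lam‖)
    (β : ℝ → ℂ) (hβ : ContDiffOn ℝ (⊤ : ℕ∞) β (Set.Ioi 0))
    (heq : ∀ x > (0:ℝ), β (φ x) = lam * β x) :
    ∃ γ : ℝ → ℂ, ContDiffOn ℝ (⊤ : ℕ∞) γ (Set.Ici 0) ∧ (∀ x > (0:ℝ), γ x = β x) ∧ γ 0 = 0 ∧
      ∀ k : ℕ, iteratedDerivWithin k γ (Set.Ici 0) 0 = 0 := by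
  set b : ℕ → ℝ → ℂ := fun k => iteratedDerivWithin k β (Ioi 0) with hbdef
  have hb : ∀ k, ∀ x > 0, HasDerivAt (b k) (b (k+1) x) x := by
    intro k x hx
    have h1 := (hβ.differentiableOn_iteratedDerivWithin (m := k)
      (by exact_mod_cast ENat.natCast_lt_top k) isOpen_Ioi.uniqueDiffOn x hx).hasDerivWithinAt
    rw [← iteratedDerivWithin_succ] at h1
    exact h1.hasDerivAt (Ioi_mem_nhds hx)
  have hb0 : b 0 = β := by simp [hbdef]
  have hrec := aux_rec φ hφs hexp lam b hb (by simpa [hb0] using heq)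
  have hc := hφs.continuousOn
  have hφt := aux_tendsto_phi φ hc hφ0 hexp
  have hcont : ∀ f : ℝ → ℝ, ContinuousOn f (Ici 0) → Tendsto f (𝓝[>] 0) (𝓝 (f 0)) :=
    fun f hf => Tendsto.mono_left (hf 0 (mem_Ici.2 le_rfl))
      (nhdsWithin_mono _ Ioi_subset_Ici_self)
  have hd1 : derivWithin φ (Ici 0) 0 = 1 := by
    have h1 := hflat 1
    rw [iteratedDerivWithin_one, derivWithin_fun_sub
      (hφs.differentiableOn (by simp) 0 (mem_Ici.2 le_rfl)) differentiableWithinAt_fun_id] at h1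
    rw [derivWithin_id' _ _ (uniqueDiffOn_Ici 0 0 (mem_Ici.2 le_rfl))] at h1
    linarith
  have hlim : ∀ k, Tendsto (b k) (𝓝[>] 0) (𝓝 0) := by
    intro k
    induction k using Nat.strong_induction_on with
    | _ k ih =>
    have hl0 : 0 < ‖lam‖ := by linarith
    obtain ⟨q, hq1, hq2⟩ : ∃ q, 1 / ‖lam‖ < q ∧ q < 1 :=
      exists_between (by rw [div_lt_one hl0]; exact hlam)
    have hq0 : 0 ≤ q := le_trans (by positivity) hq1.le
    rw [tendsto_zero_iff_norm_tendsto_zero]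
    refine aux_lim φ hc hφ0 hexp _ (fun x hx => (hb k x hx).continuousAt.norm.continuousWithinAt)
      (fun x => norm_nonneg _) q hq0 hq2
      (fun x => ‖∑ j ∈ Finset.range k, coefP φ k j x • b j (φ x)‖ / ‖lam‖) ?_ ?_
    · have h1 : Tendsto (fun x => ∑ j ∈ Finset.range k, coefP φ k j x • b j (φ x)) (𝓝[>] 0)
          (𝓝 (∑ j ∈ Finset.range k, coefP φ k j 0 • (0:ℂ))) :=
        tendsto_finsetSum _ fun j hj => (hcont _ (coefP_smooth φ hφs k j).continuousOn).smul
          ((ih j (Finset.mem_range.1 hj)).comp hφt)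
      simpa using h1.norm.div_const ‖lam‖
    · have h2 : Tendsto (fun x => |coefP φ k k x| / ‖lam‖) (𝓝[>] 0) (𝓝 (1 / ‖lam‖)) := by
        have := ((hcont _ (coefP_smooth φ hφs k k).continuousOn).abs).div_const ‖lam‖
        rwa [coefP_diag, hd1, one_pow, abs_one] at this
      filter_upwards [h2.eventually (gt_mem_nhds hq1), self_mem_nhdsWithin] with x hx hx0
      have h3 := congrArg norm (hrec k x hx0)
      rw [Finset.sum_range_succ, norm_mul] at h3
      have h4 := norm_add_le (∑ j ∈ Finset.range k, coefP φ k j x • b j (φ x))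
        (coefP φ k k x • b k (φ x))
      rw [norm_smul, Real.norm_eq_abs, ← h3] at h4
      have h5 : ‖b k x‖ ≤ (‖∑ j ∈ Finset.range k, coefP φ k j x • b j (φ x)‖
          + |coefP φ k k x| * ‖b k (φ x)‖) / ‖lam‖ := by
        rw [le_div_iff₀ hl0]; linarith
      have h6 := mul_le_mul_of_nonneg_right hx.le (norm_nonneg (b k (φ x)))
      rw [add_div, mul_div_right_comm] at h5
      linarith
  set g : ℕ → ℝ → ℂ := fun k x => if 0 < x then b k x else 0 with hg
  have hg0 : ∀ k, g k 0 = 0 := fun k => by simp [hg]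
  have hgpos : ∀ k, ∀ x > 0, g k x = b k x := fun k x hx => if_pos hx
  have hgat : ∀ k, ∀ x > 0, HasDerivAt (g k) (g (k+1) x) x := by
    intro k x hx
    rw [hgpos _ x hx]
    refine (hb k x hx).congr_of_eventuallyEq ?_
    filter_upwards [Ioi_mem_nhds hx] with y hy using hgpos k y hy
  have hglim : ∀ k, Tendsto (g k) (𝓝[>] 0) (𝓝 0) := fun k =>
    (hlim k).congr' (by filter_upwards [self_mem_nhdsWithin] with y hy using (hgpos k y hy).symm)
  have hgd : ∀ k, ∀ x ∈ Ici (0:ℝ), HasDerivWithinAt (g k) (g (k+1) x) (Ici 0) x := by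
    intro k x hx
    rcases eq_or_lt_of_le (mem_Ici.1 hx) with h | h
    · subst h
      rw [hg0]
      refine hasDerivWithinAt_Ici_of_tendsto_deriv (s := Ioi 0)
        (fun x hx => (hgat k x hx).differentiableAt.differentiableWithinAt) ?_
        self_mem_nhdsWithin ?_
      · have : Tendsto (g k) (𝓝[>] 0) (𝓝 (g k 0)) := by rw [hg0]; exact hglim k
        exact this
      · refine (hglim (k+1)).congr' ?_
        filter_upwards [self_mem_nhdsWithin] with y hy using (hgat k y hy).deriv.symm
    · exact (hgat k x h).hasDerivWithinAt
  have hit : ∀ k, EqOn (iteratedDerivWithin k (g 0) (Ici 0)) (g k) (Ici 0) := by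
    intro k
    induction k with
    | zero => intro x _; simp
    | succ k ih =>
      intro x hx
      rw [iteratedDerivWithin_succ, derivWithin_congr ih (ih hx)]
      exact (hgd k x hx).derivWithin (uniqueDiffOn_Ici 0 x hx)
  refine ⟨g 0, ?_, fun x hx => by rw [hgpos 0 x hx, hb0], hg0 0,
    fun k => by rw [hit k (mem_Ici.2 le_rfl), hg0]⟩
  refine contDiffOn_of_differentiableOn_deriv fun m _ => ?_
  exact DifferentiableOn.congr (fun x hx => (hgd m x hx).differentiableWithinAt) (hit m)
end

section
/- Let n ≥ 2, a ∈ ℝ, and ρ(x) = x^n + a·x^{2n-1}, which is positive on some interval (0, x₀]. For Λ ∈ ℂ with Re Λ > 0, any solution on (0, x₀) of the ODE β'(x) = (Λ/ρ(x))·β(x), extended by β(0) = 0, is smooth on [0, x₀) and flat at x = 0 (all one-sided derivatives vanish at 0). -/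
open Set

lemma decay_aux (n : ℕ) (hn : 2 ≤ n) (a : ℝ) (x₀ : ℝ) (hx₀ : 0 < x₀)
    (hpos : ∀ x ∈ Set.Ioc (0:ℝ) x₀, 0 < x ^ n + a * x ^ (2 * n - 1))
    (Λ : ℂ) (hΛ : 0 < Λ.re) (β : ℝ → ℂ)
    (hder : ∀ x ∈ Set.Ioo (0:ℝ) x₀,
        HasDerivAt β ((Λ / ((x : ℂ) ^ n + (a : ℂ) * (x : ℂ) ^ (2 * n - 1))) * β x) x)
    (N : ℕ) : ∃ C : ℝ, ∃ δ > 0, ∀ x ∈ Set.Ioo (0:ℝ) δ, ‖β x‖ ≤ C * x ^ N := by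
  have hcts : ContinuousAt (fun x : ℝ => (2 * N : ℝ) * (x ^ (n-1) + a * x ^ (2 * n - 2))) 0 := by
    fun_prop
  have h0 : (fun x : ℝ => (2 * N : ℝ) * (x ^ (n-1) + a * x ^ (2 * n - 2))) 0 < 2 * Λ.re := by
    have h1 : n - 1 ≠ 0 := by omega
    have h2 : 2 * n - 2 ≠ 0 := by omega
    simp [h1, h2, hΛ]
  have hev := hcts.eventually_lt_const h0
  obtain ⟨ε, hε, hball⟩ := Metric.eventually_nhds_iff.1 hev
  set d := min ε x₀ with hd
  have hdpos : 0 < d := lt_min hε hx₀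
  let h : ℝ → ℝ := fun x => ‖β x‖ ^ 2 / x ^ (2 * N)
  have hD : ∀ x ∈ Ioo (0:ℝ) d, ∃ h' : ℝ, HasDerivAt h h' x ∧ 0 ≤ h' := by
    intro x hx
    have hxx : x ∈ Ioo 0 x₀ := ⟨hx.1, hx.2.trans_le (min_le_right _ _)⟩
    have hx0 : 0 < x := hx.1
    have hρ := hpos x ⟨hxx.1, hxx.2.le⟩
    have e1 := (hder x hxx).norm_sq
    have e2 := e1.div (hasDerivAt_pow (2 * N) x) (by positivity)
    refine ⟨_, e2, ?_⟩
    have hin : inner ℝ (β x) ((Λ / ((x : ℂ) ^ n + (a : ℂ) * (x : ℂ) ^ (2 * n - 1))) * β x)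
        = Λ.re / (x ^ n + a * x ^ (2 * n - 1)) * ‖β x‖ ^ 2 := by
      have hc : (Λ / ((x : ℂ) ^ n + (a : ℂ) * (x : ℂ) ^ (2 * n - 1)))
          = Λ / ((x ^ n + a * x ^ (2 * n - 1) : ℝ) : ℂ) := by push_cast; rfl
      rw [hc, Complex.inner, mul_assoc, Complex.mul_conj, Complex.re_mul_ofReal,
        Complex.div_ofReal_re, Complex.normSq_eq_norm_sq]
    rw [hin]
    apply div_nonneg _ (by positivity)
    have hb : (2 * N : ℝ) * (x ^ (n-1) + a * x ^ (2 * n - 2)) < 2 * Λ.re := by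
      apply hball
      rw [Real.dist_eq, sub_zero, abs_of_pos hx0]
      exact hx.2.trans_le (min_le_left _ _)
    have hρx : x ^ n + a * x ^ (2 * n - 1) = x * (x ^ (n-1) + a * x ^ (2 * n - 2)) := by
      obtain ⟨k, rfl⟩ := Nat.exists_eq_add_of_le hn
      rw [show 2 + k - 1 = k + 1 by omega, show 2 * (2 + k) - 1 = 2 * k + 3 by omega,
        show 2 * (2 + k) - 2 = 2 * k + 2 by omega]
      ring
    have hkey : (2 * N : ℝ) / x ≤ 2 * (Λ.re / (x ^ n + a * x ^ (2 * n - 1))) := by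
      rw [← mul_div_assoc, div_le_div_iff₀ hx0 hρ, hρx]
      nlinarith
    have hpw : ((2 * N : ℕ) : ℝ) * x ^ (2 * N - 1) = (2 * N : ℝ) / x * x ^ (2 * N) := by
      rcases Nat.eq_zero_or_pos N with rfl | hN
      · simp
      · obtain ⟨k, hk⟩ : ∃ k, 2 * N = k + 1 := ⟨2 * N - 1, by omega⟩
        rw [hk, Nat.add_sub_cancel, pow_succ, ← hk]
        push_cast
        field_simp
    rw [hpw]
    have hB : 0 ≤ ‖β x‖ ^ 2 * x ^ (2 * N) := by positivity
    have := mul_le_mul_of_nonneg_right hkey hB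
    nlinarith
  have hmono : MonotoneOn h (Ioo 0 d) := by
    apply monotoneOn_of_deriv_nonneg (convex_Ioo 0 d)
    · intro x hx
      obtain ⟨h', hh, _⟩ := hD x hx
      exact hh.continuousAt.continuousWithinAt
    · intro x hx
      rw [interior_Ioo] at hx
      obtain ⟨h', hh, _⟩ := hD x hx
      exact hh.differentiableAt.differentiableWithinAt
    · intro x hx
      rw [interior_Ioo] at hx
      obtain ⟨h', hh, hn⟩ := hD x hx
      rw [hh.deriv]; exact hn
  refine ⟨Real.sqrt (h (d/2)), d/2, by positivity, fun x hx => ?_⟩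
  have hx0 : 0 < x := hx.1
  have hle : h x ≤ h (d/2) := hmono ⟨hx.1, by linarith [hx.2]⟩ ⟨by linarith, by linarith⟩ hx.2.le
  have h3 : ‖β x‖ ^ 2 ≤ h (d/2) * x ^ (2 * N) := (div_le_iff₀ (by positivity)).1 hle
  have h4 : 0 ≤ h (d/2) := by positivity
  refine (sq_le_sq₀ (norm_nonneg _) (by positivity)).1 ?_
  rw [mul_pow, Real.sq_sqrt h4, ← pow_mul, mul_comm N 2]
  exact h3

theorem stmt11 (n : ℕ) (hn : 2 ≤ n) (a : ℝ) (x₀ : ℝ) (hx₀ : 0 < x₀)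
    (hpos : ∀ x ∈ Set.Ioc (0:ℝ) x₀, 0 < x ^ n + a * x ^ (2 * n - 1))
    (Λ : ℂ) (hΛ : 0 < Λ.re)
    (β : ℝ → ℂ) (hβ0 : β 0 = 0)
    (hcont : ContDiffOn ℝ (⊤ : ℕ∞) β (Set.Ioo 0 x₀))
    (hder : ∀ x ∈ Set.Ioo (0:ℝ) x₀,
        HasDerivAt β ((Λ / ((x : ℂ) ^ n + (a : ℂ) * (x : ℂ) ^ (2 * n - 1))) * β x) x) :
    ContDiffOn ℝ (⊤ : ℕ∞) β (Set.Ico 0 x₀) ∧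
      ∀ k : ℕ, iteratedDerivWithin k β (Set.Ico 0 x₀) 0 = 0 := by
  let R : Polynomial ℂ := Polynomial.X ^ n + Polynomial.C (a : ℂ) * Polynomial.X ^ (2 * n - 1)
  have hR : ∀ x : ℝ, R.eval (x : ℂ) = (x : ℂ) ^ n + (a : ℂ) * (x : ℂ) ^ (2 * n - 1) := by
    intro x; simp [R]
  have hR' : ∀ x : ℝ, R.eval (x : ℂ) = ((x ^ n + a * x ^ (2 * n - 1) : ℝ) : ℂ) := by
    intro x; rw [hR]; push_cast; rfl
  let f : Polynomial ℂ → ℕ → ℝ → ℂ := fun q m x => q.eval (x : ℂ) / (R.eval (x : ℂ)) ^ m * β x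
  let D : Polynomial ℂ → ℕ → Polynomial ℂ := fun q m =>
    Polynomial.derivative q * R - Polynomial.C (m : ℂ) * q * Polynomial.derivative R
      + Polynomial.C Λ * q
  have hf0 : ∀ q m, f q m 0 = 0 := by intro q m; simp [f, hβ0]
  have hzero : ∀ q m, HasDerivWithinAt (f q m) 0 (Ico 0 x₀) 0 := by
    intro q m
    obtain ⟨C, δ, hδ, hC⟩ := decay_aux n hn a x₀ hx₀ hpos Λ hΛ β hder (n * m + 2)
    have hlow : ∀ᶠ x : ℝ in nhds 0, 1 / 2 < 1 + a * x ^ (n - 1) := by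
      have hc : ContinuousAt (fun x : ℝ => 1 + a * x ^ (n - 1)) 0 := by fun_prop
      apply hc.eventually_const_lt
      have h1 : n - 1 ≠ 0 := by omega
      simp [h1]; norm_num
    have hq : ∀ᶠ x : ℝ in nhds 0, ‖q.eval (x : ℂ)‖ < ‖q.eval 0‖ + 1 := by
      have hc : ContinuousAt (fun x : ℝ => ‖q.eval (x : ℂ)‖) 0 := by
        have : Continuous (fun x : ℝ => q.eval (x : ℂ)) := q.continuous.comp Complex.continuous_ofReal
        exact this.norm.continuousAt
      apply hc.eventually_lt_const
      simp
    have hbig : f q m =O[nhdsWithin 0 (Ico 0 x₀)] fun x => x ^ 2 := by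
      apply Asymptotics.IsBigO.of_bound ((‖q.eval 0‖ + 1) * 2 ^ m * C)
      have hdl : ∀ᶠ x : ℝ in nhds 0, x < δ := gt_mem_nhds hδ
      filter_upwards [nhdsWithin_le_nhds hlow, nhdsWithin_le_nhds hq, nhdsWithin_le_nhds hdl,
        self_mem_nhdsWithin] with x h1 h2 h3 h4
      rcases h4.1.eq_or_lt with h5 | h5
      · rw [← h5, hf0]; simp
      have hb := hC x ⟨h5, h3⟩
      have hρx : x ^ n + a * x ^ (2 * n - 1) = x ^ n * (1 + a * x ^ (n-1)) := by
        rw [show 2 * n - 1 = n + (n - 1) by omega, pow_add]; ring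
      have hRn : x ^ n / 2 ≤ ‖R.eval (x : ℂ)‖ := by
        rw [hR', hρx, Complex.norm_real, Real.norm_eq_abs]
        refine le_trans ?_ (le_abs_self _)
        have : 0 < x ^ n := by positivity
        nlinarith
      have hxn : 0 < x ^ n / 2 := by positivity
      have e : ‖f q m x‖ = ‖q.eval (x : ℂ)‖ / ‖R.eval (x : ℂ)‖ ^ m * ‖β x‖ := by
        simp [f]
      rw [e]
      calc ‖q.eval (x : ℂ)‖ / ‖R.eval (x : ℂ)‖ ^ m * ‖β x‖
          ≤ (‖q.eval 0‖ + 1) / (x ^ n / 2) ^ m * (C * x ^ (n * m + 2)) := by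
            gcongr
        _ = (‖q.eval 0‖ + 1) * 2 ^ m * C * ‖x ^ 2‖ := by
            rw [Real.norm_of_nonneg (by positivity), pow_add, pow_mul, div_pow]
            field_simp
    have hlit : (fun x : ℝ => x ^ 2) =o[nhdsWithin 0 (Ico 0 x₀)] fun x => x := by
      have := (Asymptotics.isLittleO_pow_id (𝕜 := ℝ) (n := 2) (by norm_num))
      exact this.mono nhdsWithin_le_nhds
    rw [hasDerivWithinAt_iff_isLittleO]
    simpa [hf0] using hbig.trans_isLittleO hlit
  have hderf : ∀ q m, ∀ x ∈ Ico 0 x₀,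
      HasDerivWithinAt (f q m) (f (D q m) (m + 1) x) (Ico 0 x₀) x := by
    intro q m x hx
    rcases hx.1.eq_or_lt with h5 | h5
    · rw [← h5, hf0]; exact hzero q m
    have hρ := hpos x ⟨h5, hx.2.le⟩
    have hRne : R.eval (x : ℂ) ≠ 0 := by
      rw [hR']; exact_mod_cast hρ.ne'
    have hb := hder x ⟨h5, hx.2⟩
    rw [← hR] at hb
    have hq := (q.hasDerivAt (x : ℂ)).comp_ofReal
    have hRd := ((R.hasDerivAt (x : ℂ)).comp_ofReal).pow m
    have := ((hq.div hRd (pow_ne_zero m hRne)).mul hb).hasDerivWithinAt (s := Ico 0 x₀)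
    refine this.congr_deriv ?_
    simp only [f, D, Polynomial.eval_add, Polynomial.eval_sub, Polynomial.eval_mul,
      Polynomial.eval_C, Pi.pow_apply, Pi.div_apply]
    rcases m with _ | m
    · simp; field_simp
    · rw [Nat.add_sub_cancel]
      field_simp
      ring
  have huniq : UniqueDiffOn ℝ (Ico 0 x₀) := uniqueDiffOn_Ico 0 x₀
  have hdw : ∀ q m, EqOn (derivWithin (f q m) (Ico 0 x₀)) (f (D q m) (m + 1)) (Ico 0 x₀) :=
    fun q m x hx => (hderf q m x hx).derivWithin (huniq x hx)
  have hsm : ∀ k : ℕ, ∀ q m, ContDiffOn ℝ k (f q m) (Ico 0 x₀) := by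
    intro k
    induction k with
    | zero =>
      intro q m
      exact contDiffOn_zero.2 fun x hx => (hderf q m x hx).continuousWithinAt
    | succ k ih =>
      intro q m
      push_cast
      rw [contDiffOn_succ_iff_derivWithin huniq]
      refine ⟨fun x hx => (hderf q m x hx).differentiableWithinAt, by simp, ?_⟩
      exact (ih (D q m) (m + 1)).congr (hdw q m)
  have hit : ∀ k : ℕ, ∀ q m, iteratedDerivWithin k (f q m) (Ico 0 x₀) 0 = 0 := by
    intro k
    have h0m : (0:ℝ) ∈ Ico 0 x₀ := ⟨le_rfl, hx₀⟩
    induction k with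
    | zero => intro q m; simp [hf0]
    | succ k ih =>
      intro q m
      rw [iteratedDerivWithin_succ', iteratedDerivWithin_congr (hdw q m) h0m]
      exact ih _ _
  have hβ : f 1 0 = β := by funext x; simp [f]
  rw [← hβ]
  exact ⟨contDiffOn_infty.2 fun k => hsm k 1 0, fun k => hit k 1 0⟩
end
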